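/- Let G be a finite group, C ⊆ G a conjugacy class, g ∈ G, and ℓ ≥ 1. Let (π_i)_{i ∈ I} be a finite family of irreducible finite-dimensional complex representations of G that are pairwise non-isomorphic and complete, i.e. Σ_{i∈I} (dim π_i)² = #G. Then for any c ∈ C, #{ (c₁, …, c_ℓ) ∈ C^ℓ : c₁ ⋯ c_ℓ = g } = (#(C)^ℓ / #G) · Σ_{i∈I} dim(π_i) · (χ_{π_i}(c) / dim(π_i))^ℓ · χ_{π_i}(g^{-1}), where χ_π denotes the character of π (note χ_π(c) is independent of the choice of c ∈ C). -/

import Mathlib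

open CategoryTheory
open scoped BigOperators

/-- The value at `g⁻¹` of the trace of a complex matrix representation of a finite group is the
complex conjugate of the value at `g`. -/
theorem Matrix.trace_map_inv_eq_star {G n : Type*} [Group G] [Fintype G] [Fintype n]
    [DecidableEq n] (ρ : G →* Matrix n n ℂ) (g : G) :
    (ρ g⁻¹).trace = star (ρ g).trace := by
  open scoped ComplexOrder in
  set M : Matrix n n ℂ := ∑ x : G, (ρ x).conjTranspose * ρ x with hM
  have hMpos : M.PosDef := by
    refine Matrix.posDef_sum Finset.univ_nonempty fun x _ => ?_
    have hx : IsUnit (ρ x) := (Group.isUnit x).map ρ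
    simpa using (Matrix.PosDef.one (n := n) (R := ℂ)).conjTranspose_mul_mul_same
      (Matrix.mulVec_injective_of_isUnit hx)
  have hinv : (ρ g).conjTranspose * M * ρ g = M := by
    rw [hM, Finset.mul_sum, Finset.sum_mul]
    refine Fintype.sum_equiv (Equiv.mulRight g) _ _ fun x => ?_
    simp [Matrix.conjTranspose_mul, Matrix.mul_assoc]
  have hcomm : M * ρ g⁻¹ = (ρ g).conjTranspose * M := by
    conv_lhs => rw [← hinv]
    rw [Matrix.mul_assoc, ← map_mul, mul_inv_cancel, map_one, Matrix.mul_one]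
  have hdet : IsUnit M.det := (Matrix.isUnit_iff_isUnit_det M).1 hMpos.isUnit
  calc (ρ g⁻¹).trace = (M⁻¹ * (M * ρ g⁻¹)).trace := by
        rw [Matrix.nonsing_inv_mul_cancel_left _ _ hdet]
    _ = star (ρ g).trace := by
        rw [hcomm, Matrix.trace_mul_comm, Matrix.mul_nonsing_inv_cancel_right _ _ hdet,
          Matrix.trace_conjTranspose]

theorem FDRep.char_inv_eq_star {G : Type} [Group G] [Fintype G] (V : FDRep ℂ G) (g : G) :
    V.character g⁻¹ = star (V.character g) := by
  classical
  let b := Module.finBasis ℂ V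
  have h (x : G) : V.character x = (LinearMap.toMatrixAlgEquiv b (V.ρ x)).trace :=
    LinearMap.trace_eq_matrix_trace ℂ b (V.ρ x)
  rw [h, h]
  exact Matrix.trace_map_inv_eq_star
    ((MonoidHomClass.toMonoidHom (LinearMap.toMatrixAlgEquiv b)).comp V.ρ) g

/-- Column orthogonality against the identity: a complete family of irreducible characters
decomposes the regular character. -/
theorem FDRep.sum_finrank_mul_char {G : Type} [Group G] [Fintype G] [DecidableEq G]
    {I : Type} [Fintype I] (π : I → FDRep ℂ G) (hirr : ∀ i, Simple (π i))
    (hpairwise : ∀ i j, i ≠ j → ¬ Nonempty (π i ≅ π j))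
    (hcomplete : ∑ i : I, (Module.finrank ℂ (π i)) ^ 2 = Fintype.card G) (x : G) :
    ∑ i, (Module.finrank ℂ (π i) : ℂ) * (π i).character x =
      if x = 1 then (Fintype.card G : ℂ) else 0 := by
  classical
  set N : ℂ := (Fintype.card G : ℂ) with hN
  have hN0 : N ≠ 0 := by simp [hN]
  set d : I → ℂ := fun i => (Module.finrank ℂ (π i) : ℂ) with hd
  set R : G → ℂ := fun x => ∑ i, d i * (π i).character x with hR
  set φ : G → ℂ := fun x => R x - if x = 1 then N else 0 with hφ
  have hsq : ∑ i, d i * d i = N := by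
    rw [hN, ← hcomplete]
    push_cast
    exact Finset.sum_congr rfl fun i _ => (sq _).symm
  have hR1 : R 1 = N := by simpa [hR, FDRep.char_one] using hsq
  have horth (i j : I) :
      ∑ x : G, (π i).character x * (π j).character x⁻¹ = if i = j then N else 0 := by
    have hcard : (Nat.card G : ℂ) = N := by rw [hN, Nat.card_eq_fintype_card]
    have : Invertible (Nat.card G : ℂ) := invertibleOfNonzero (hcard ▸ hN0)
    have := hirr i
    have := hirr j
    have h := FDRep.char_orthonormal (π i) (π j)
    rw [hcard, inv_mul_eq_iff_eq_mul₀ hN0] at h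
    rw [h]
    by_cases hij : i = j
    · subst hij
      simp [show Nonempty (π i ≅ π i) from ⟨Iso.refl _⟩]
    · simp [hij, hpairwise i j hij]
  have hRR : ∑ x, R x * R x⁻¹ = N * N := by
    calc ∑ x, R x * R x⁻¹
        = ∑ x, ∑ i, ∑ j, d i * d j * ((π i).character x * (π j).character x⁻¹) := by
          refine Finset.sum_congr rfl fun x _ => ?_
          rw [hR, Finset.sum_mul_sum]
          exact Finset.sum_congr rfl fun i _ => Finset.sum_congr rfl fun j _ => by ring
      _ = ∑ i, ∑ j, d i * d j * ∑ x, ((π i).character x * (π j).character x⁻¹) := by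
          rw [Finset.sum_comm]
          refine Finset.sum_congr rfl fun i _ => ?_
          rw [Finset.sum_comm]
          simp only [Finset.mul_sum]
      _ = N * N := by
          simp only [horth, mul_ite, mul_zero, Finset.sum_ite_eq, Finset.mem_univ, if_true]
          rw [← Finset.sum_mul, hsq]
  have hzero : ∑ x, φ x * φ x⁻¹ = 0 := by
    simp only [hφ, sub_mul, mul_sub, Finset.sum_sub_distrib, hRR]
    simp [hR1]
  have hstar (x : G) : φ x⁻¹ = star (φ x) := by
    simp only [hφ, hR, star_sub, star_sum, star_mul', FDRep.char_inv_eq_star, inv_eq_one]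
    split_ifs <;> simp [hd, hN]
  have hnorm : ∑ x, ‖φ x‖ ^ 2 = 0 := by
    have : ((∑ x, ‖φ x‖ ^ 2 : ℝ) : ℂ) = 0 := by
      rw [← hzero]
      push_cast
      exact Finset.sum_congr rfl fun x _ => by rw [hstar]; exact (Complex.mul_conj' _).symm
    exact_mod_cast this
  have hx := (Finset.sum_eq_zero_iff_of_nonneg fun x _ => sq_nonneg ‖φ x‖).1 hnorm x
    (Finset.mem_univ x)
  exact sub_eq_zero.1 (norm_eq_zero.1 (pow_eq_zero_iff two_ne_zero |>.1 hx))

/-- **Schur's lemma** for a linear endomorphism commuting with the group action. -/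
theorem FDRep.exists_eq_smul_one_of_commute {k : Type*} [Field k] [IsAlgClosed k] {G : Type*}
    [Monoid G] (V : FDRep k G) [Simple V] (f : V →ₗ[k] V) (hf : ∀ x, Commute f (V.ρ x)) :
    ∃ a : k, f = a • (1 : V →ₗ[k] V) := by
  let F : V ⟶ V := ⟨InducedCategory.homMk (ModuleCat.ofHom f), fun x => by
    ext v
    exact LinearMap.congr_fun (hf x).eq v⟩
  obtain ⟨a, ha⟩ := endomorphism_simple_eq_smul_id k F
  refine ⟨a, ?_⟩
  have := congrArg (fun h : V ⟶ V => h.hom.hom.hom) ha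
  exact this.symm

/-- The sum of the elements of a conjugation-invariant finite set on which the character is
constant acts on an irreducible representation by a scalar. -/
theorem FDRep.finrank_smul_sum_rho {k : Type*} [Field k] [IsAlgClosed k] {G : Type*} [Group G]
    (V : FDRep k G) [Simple V] (s : Finset G) (hs : ∀ x y, x ∈ s → y * x * y⁻¹ ∈ s) (χ : k)
    (hχ : ∀ x ∈ s, V.character x = χ) :
    (Module.finrank k V : k) • ∑ x ∈ s, V.ρ x = (s.card * χ) • (1 : V →ₗ[k] V) := by
  have hconj (y : G) : V.ρ y * ∑ x ∈ s, V.ρ x = (∑ x ∈ s, V.ρ x) * V.ρ y := by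
    rw [Finset.mul_sum, Finset.sum_mul]
    refine Finset.sum_bij' (fun x _ => y * x * y⁻¹) (fun x _ => y⁻¹ * x * y)
      (fun x hx => hs x y hx) (fun x hx => by simpa using hs x y⁻¹ hx) ?_ ?_ ?_
    · intro x _; group
    · intro x _; group
    · intro x _; simp [← map_mul]
  obtain ⟨a, ha⟩ := V.exists_eq_smul_one_of_commute _ fun y => (hconj y).symm
  have htr : (s.card : k) * χ = a * Module.finrank k V := by
    have := congrArg (LinearMap.trace k V) ha
    rw [map_sum, map_smul, LinearMap.trace_one, smul_eq_mul] at this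
    rw [← this, ← nsmul_eq_mul, ← Finset.sum_const]
    exact Finset.sum_congr rfl fun x hx => (hχ x hx).symm
  rw [ha, smul_smul, htr, mul_comm]

theorem MonoidHom.sum_pow_eq_sum_prod_ofFn {M A : Type*} [Monoid M] [Semiring A] (f : M →* A)
    (s : Set M) [Fintype s] (n : ℕ) :
    (∑ x : s, f x) ^ n = ∑ t : Fin n → s, f (List.ofFn fun i => (t i : M)).prod := by
  induction n with
  | zero => simp
  | succ n ih =>
    rw [pow_succ', ih, ← (Fin.consEquiv fun _ => s).sum_comp, Fintype.sum_prod_type,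
      Finset.sum_mul_sum]
    simp [List.ofFn_succ]

/-- Frobenius-type formula: let `G` be a finite group, `C ⊆ G` a conjugacy
class, `g ∈ G`, `ℓ ≥ 1`, and `(π i)_{i ∈ I}` a complete finite family of pairwise
non-isomorphic irreducible complex representations of `G` (completeness being expressed by
`Σ_i (dim π_i)² = #G`).  Then for any `c ∈ C`,
`#{(c₁,…,c_ℓ) ∈ C^ℓ : c₁⋯c_ℓ = g}
   = (#C^ℓ/#G) · Σ_i dim(π_i) (χ_{π_i}(c)/dim(π_i))^ℓ χ_{π_i}(g⁻¹)`. -/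
theorem frobenius_count_formula
    (G : Type) [Group G] [Fintype G]
    (C : Set G) (hC : ∃ x : G, C = {y : G | IsConj x y})
    (g : G) (ℓ : ℕ) (hℓ : 1 ≤ ℓ)
    (I : Type) [Fintype I] (π : I → FDRep ℂ G)
    (hirr : ∀ i, Simple (π i))
    (hpairwise : ∀ i j, i ≠ j → ¬ Nonempty (π i ≅ π j))
    (hcomplete : ∑ i : I, (Module.finrank ℂ (π i)) ^ 2 = Fintype.card G)
    (c : G) (hc : c ∈ C) :
    (Nat.card {t : Fin ℓ → G // (∀ i, t i ∈ C) ∧ (List.ofFn t).prod = g} : ℂ) =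
      ((Nat.card C : ℂ) ^ ℓ / (Fintype.card G : ℂ)) *
        ∑ i : I, (Module.finrank ℂ (π i) : ℂ) *
          ((π i).character c / (Module.finrank ℂ (π i) : ℂ)) ^ ℓ *
          (π i).character g⁻¹ := by
  classical
  obtain ⟨x₀, rfl⟩ := hC
  set C : Set G := {y : G | IsConj x₀ y} with hC
  set N : ℂ := (Fintype.card G : ℂ) with hN
  have hN0 : N ≠ 0 := by simp [hN]
  have hscalar (i : I) : (Module.finrank ℂ (π i) : ℂ) • ∑ x : C, (π i).ρ x =
      (Nat.card C * (π i).character c) • (1 : π i →ₗ[ℂ] π i) := by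
    have := hirr i
    have h := (π i).finrank_smul_sum_rho C.toFinset
      (fun x y hx => by
        rw [Set.mem_toFinset] at hx ⊢
        exact IsConj.trans hx (isConj_iff.2 ⟨y, rfl⟩))
      ((π i).character c)
      (fun x hx => by
        rw [Set.mem_toFinset] at hx
        obtain ⟨y, rfl⟩ := isConj_iff.1 (IsConj.trans (IsConj.symm hc) hx)
        exact (π i).char_conj c y)
    rwa [Set.toFinset_card, ← Nat.card_eq_fintype_card,
      Finset.sum_subtype C.toFinset (fun x => Set.mem_toFinset) fun x => (π i).ρ x] at h
  have hchar (i : I) : (Module.finrank ℂ (π i) : ℂ) * ∑ t : Fin ℓ → C,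
      (π i).character (g⁻¹ * (List.ofFn fun j => (t j : G)).prod) =
      (Nat.card C : ℂ) ^ ℓ * ((Module.finrank ℂ (π i) : ℂ) *
        ((π i).character c / (Module.finrank ℂ (π i) : ℂ)) ^ ℓ * (π i).character g⁻¹) := by
    by_cases hd : (Module.finrank ℂ (π i) : ℂ) = 0
    · simp [hd]
    have hz : ∑ x : C, (π i).ρ x = (Nat.card C * ((π i).character c /
        (Module.finrank ℂ (π i) : ℂ))) • (1 : π i →ₗ[ℂ] π i) := by
      rw [← inv_smul_smul₀ hd (∑ x : C, (π i).ρ x), hscalar, smul_smul]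
      congr 1
      field_simp
    have hsum : ∑ t : Fin ℓ → C, (π i).character (g⁻¹ * (List.ofFn fun j => (t j : G)).prod) =
        LinearMap.trace ℂ (π i) ((π i).ρ g⁻¹ * (∑ x : C, (π i).ρ x) ^ ℓ) := by
      rw [MonoidHom.sum_pow_eq_sum_prod_ofFn, Finset.mul_sum, map_sum]
      simp only [← map_mul]
      rfl
    rw [hsum, hz, smul_pow, one_pow, mul_smul_comm, mul_one, map_smul, smul_eq_mul, mul_pow]
    change _ * (_ * (π i).character g⁻¹) = _
    ring
  have hcount : (Nat.card {t : Fin ℓ → G // (∀ i, t i ∈ C) ∧ (List.ofFn t).prod = g} : ℂ) =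
      ∑ t : Fin ℓ → C, if g⁻¹ * (List.ofFn fun j => (t j : G)).prod = 1 then (1 : ℂ) else 0 := by
    rw [Finset.sum_boole, ← Fintype.card_subtype, ← Nat.card_eq_fintype_card]
    congr 1
    refine Nat.card_congr
      { toFun := fun t => ⟨fun j => ⟨t.1 j, t.2.1 j⟩, by simp [t.2.2]⟩
        invFun := fun t => ⟨fun j => t.1 j, fun j => (t.1 j).2, (inv_mul_eq_one.1 t.2).symm⟩
        left_inv := fun t => rfl
        right_inv := fun t => rfl }
  rw [hcount, div_mul_eq_mul_div, eq_div_iff hN0, Finset.mul_sum, Finset.sum_mul]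
  simp only [← hchar, Finset.mul_sum]
  rw [Finset.sum_comm]
  refine Finset.sum_congr rfl fun t _ => ?_
  rw [FDRep.sum_finrank_mul_char π hirr hpairwise hcomplete]
  simp [hN]
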